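/- arXiv:2605.00837 — 3 statements merged into one kernel-verified Lean document; each statement's English description precedes it below -/
import Mathlib

section
/- Let $n, m \geq 1$, let $C \in \mathbb{R}^{n \times m}$, let $\mu \in \Sigma_n$ and $\nu \in \Sigma_m$ have strictly positive entries, and let $\varepsilon > 0$. If $\pi^\varepsilon$ minimizes the entropic objective $F_\varepsilon(\pi) = \sum_{i,j} C_{ij}\pi_{ij} + \varepsilon\, \mathrm{KL}(\pi \| \mu \otimes \nu)$ over the coupling set $\Pi(\mu,\nu)$, then there exist dual potentials $\alpha \in \mathbb{R}^n$ and $\beta \in \mathbb{R}^m$ such that $\pi^\varepsilon_{ij} = \mu_i \, \nu_j \, \exp((\alpha_i + \beta_j - C_{ij})/\varepsilon)$ for all $i, j$; in particular, all entries of $\pi^\varepsilon$ are strictly positive. -/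
/-- The coupling set `Π(μ, ν)`: nonnegative matrices with prescribed marginals. -/
def IsCoupling {n m : ℕ} (μ : Fin n → ℝ) (ν : Fin m → ℝ)
    (π : Fin n → Fin m → ℝ) : Prop :=
  (∀ i j, 0 ≤ π i j) ∧ (∀ i, ∑ j, π i j = μ i) ∧ (∀ j, ∑ i, π i j = ν j)

/-- The entropic objective `F_ε(π) = ⟨C, π⟩ + ε KL(π ‖ μ ⊗ ν)` (with the convention
`0 log 0 = 0`, which holds automatically since `0 * (Real.log _ - 1) = 0`). -/
noncomputable def entropicObj {n m : ℕ} (C : Fin n → Fin m → ℝ)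
    (μ : Fin n → ℝ) (ν : Fin m → ℝ) (ε : ℝ) (π : Fin n → Fin m → ℝ) : ℝ :=
  (∑ i, ∑ j, C i j * π i j) +
    ε * ((∑ i, ∑ j, π i j * (Real.log (π i j / (μ i * ν j)) - 1)) + 1)

/-- The contribution of a single entry `x`, with reference weight `w` and cost `c`, to the
entropic objective. -/
noncomputable def entropicTerm (ε c w x : ℝ) : ℝ :=
  c * x + ε * (x * (Real.log (x / w) - 1))

theorem entropicObj_eq_sum_entropicTerm {n m : ℕ} (C : Fin n → Fin m → ℝ)
    (μ : Fin n → ℝ) (ν : Fin m → ℝ) (ε : ℝ) (π : Fin n → Fin m → ℝ) :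
    entropicObj C μ ν ε π = (∑ i, ∑ j, entropicTerm ε (C i j) (μ i * ν j) (π i j)) + ε := by
  simp only [entropicObj, entropicTerm, Finset.sum_add_distrib, ← Finset.mul_sum]
  ring

theorem convexOn_entropicTerm {ε w : ℝ} (c : ℝ) (hε : 0 ≤ ε) (hw : w ≠ 0) :
    ConvexOn ℝ (Set.Ici 0) (entropicTerm ε c w) := by
  have hlin : ConvexOn ℝ (Set.Ici (0 : ℝ)) fun x => (c - ε * (Real.log w + 1)) * x :=
    (LinearMap.mul ℝ ℝ (c - ε * (Real.log w + 1))).convexOn (convex_Ici 0)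
  refine ((Real.convexOn_mul_log.smul hε).add hlin).congr fun x _ => ?_
  rcases eq_or_ne x 0 with rfl | hx
  · simp [entropicTerm]
  · simp only [entropicTerm, Real.log_div hx hw, Pi.add_apply, smul_eq_mul]
    ring

theorem hasDerivAt_entropicTerm (ε c : ℝ) {w x : ℝ} (hw : w ≠ 0) (hx : x ≠ 0) :
    HasDerivAt (entropicTerm ε c w) (c + ε * Real.log (x / w)) x := by
  have hlog : HasDerivAt (fun y => Real.log (y / w)) (1 / w / (x / w)) x :=
    ((hasDerivAt_id x).div_const w).log (div_ne_zero hx hw)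
  have h := ((hasDerivAt_id x).const_mul c).add
    (((hasDerivAt_id x).mul (hlog.sub_const 1)).const_mul ε)
  refine h.congr_deriv ?_
  simp only [id]
  field_simp
  ring

theorem entropicTerm_mul_self (ε c : ℝ) {w : ℝ} (t : ℝ) (hw : w ≠ 0) :
    entropicTerm ε c w (t * w) = t * entropicTerm ε c w w + ε * (t * w) * Real.log t := by
  simp only [entropicTerm, mul_div_cancel_right₀ t hw, div_self hw, Real.log_one]
  ring

theorem isCoupling_mul {n m : ℕ} {μ : Fin n → ℝ} {ν : Fin m → ℝ}
    (hμ : ∀ i, 0 ≤ μ i) (hμsum : ∑ i, μ i = 1) (hν : ∀ j, 0 ≤ ν j) (hνsum : ∑ j, ν j = 1) :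
    IsCoupling μ ν fun i j => μ i * ν j :=
  ⟨fun i j => mul_nonneg (hμ i) (hν j), fun i => by rw [← Finset.mul_sum, hνsum, mul_one],
    fun j => by rw [← Finset.sum_mul, hμsum, one_mul]⟩

theorem IsCoupling.convexComb {n m : ℕ} {μ : Fin n → ℝ} {ν : Fin m → ℝ}
    {π ρ : Fin n → Fin m → ℝ} (hπ : IsCoupling μ ν π) (hρ : IsCoupling μ ν ρ)
    {t : ℝ} (ht0 : 0 ≤ t) (ht1 : t ≤ 1) :
    IsCoupling μ ν fun i j => (1 - t) * π i j + t * ρ i j := by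
  refine ⟨fun i j => add_nonneg (mul_nonneg (sub_nonneg.2 ht1) (hπ.1 i j))
    (mul_nonneg ht0 (hρ.1 i j)), fun i => ?_, fun j => ?_⟩
  · rw [Finset.sum_add_distrib, ← Finset.mul_sum, ← Finset.mul_sum, hπ.2.1, hρ.2.1]
    ring
  · rw [Finset.sum_add_distrib, ← Finset.mul_sum, ← Finset.mul_sum, hπ.2.2, hρ.2.2]
    ring

/-- Moving a coupling that vanishes at `(a, b)` towards the product coupling decreases the
entropic objective at rate `t * log t`. -/
theorem entropicObj_convexComb_le {n m : ℕ} (C : Fin n → Fin m → ℝ)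
    {μ : Fin n → ℝ} {ν : Fin m → ℝ} (hμ : ∀ i, 0 < μ i) (hν : ∀ j, 0 < ν j)
    {ε : ℝ} (hε : 0 ≤ ε) {π : Fin n → Fin m → ℝ} (hπ : ∀ i j, 0 ≤ π i j)
    {a : Fin n} {b : Fin m} (hab : π a b = 0) {t : ℝ} (ht0 : 0 ≤ t) (ht1 : t ≤ 1) :
    entropicObj C μ ν ε (fun i j => (1 - t) * π i j + t * (μ i * ν j)) ≤
      (1 - t) * entropicObj C μ ν ε π + t * entropicObj C μ ν ε (fun i j => μ i * ν j) +
        ε * (t * (μ a * ν b)) * Real.log t := by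
  have hw : ∀ i j, 0 < μ i * ν j := fun i j => mul_pos (hμ i) (hν j)
  let gap : Fin n → Fin m → ℝ := fun i j =>
    (1 - t) * entropicTerm ε (C i j) (μ i * ν j) (π i j) +
      t * entropicTerm ε (C i j) (μ i * ν j) (μ i * ν j) -
      entropicTerm ε (C i j) (μ i * ν j) ((1 - t) * π i j + t * (μ i * ν j))
  have hgap : ∀ i j, 0 ≤ gap i j := fun i j =>
    sub_nonneg.2 <| (convexOn_entropicTerm (C i j) hε (hw i j).ne').2 (Set.mem_Ici.2 (hπ i j))
      (Set.mem_Ici.2 (hw i j).le) (sub_nonneg.2 ht1) ht0 (sub_add_cancel 1 t)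
  have hgap_ab : gap a b = -(ε * (t * (μ a * ν b)) * Real.log t) := by
    have hzero : entropicTerm ε (C a b) (μ a * ν b) 0 = 0 := by simp [entropicTerm]
    simp only [gap, hab, mul_zero, zero_add, entropicTerm_mul_self ε (C a b) t (hw a b).ne', hzero]
    ring
  have hle : gap a b ≤ ∑ i, ∑ j, gap i j :=
    (Finset.single_le_sum (f := gap a) (fun j _ => hgap a j) (Finset.mem_univ b)).trans
      (Finset.single_le_sum (f := fun i => ∑ j, gap i j)
        (fun i _ => Finset.sum_nonneg fun j _ => hgap i j) (Finset.mem_univ a))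
  rw [hgap_ab] at hle
  simp only [gap, Finset.sum_sub_distrib, Finset.sum_add_distrib, ← Finset.mul_sum] at hle
  simp only [entropicObj_eq_sum_entropicTerm]
  linarith

theorem pos_of_entropic_minimizer {n m : ℕ} {C : Fin n → Fin m → ℝ}
    {μ : Fin n → ℝ} {ν : Fin m → ℝ}
    (hμ : ∀ i, 0 < μ i) (hμsum : ∑ i, μ i = 1) (hν : ∀ j, 0 < ν j) (hνsum : ∑ j, ν j = 1)
    {ε : ℝ} (hε : 0 < ε) {π : Fin n → Fin m → ℝ} (hπ : IsCoupling μ ν π)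
    (hmin : ∀ π', IsCoupling μ ν π' → entropicObj C μ ν ε π ≤ entropicObj C μ ν ε π')
    (a : Fin n) (b : Fin m) : 0 < π a b := by
  refine (hπ.1 a b).lt_of_ne' fun hab => ?_
  have hprod := isCoupling_mul (fun i => (hμ i).le) hμsum (fun j => (hν j).le) hνsum
  set Δ := entropicObj C μ ν ε (fun i j => μ i * ν j) - entropicObj C μ ν ε π with hΔ
  have hΔ0 : 0 ≤ Δ := sub_nonneg.2 (hmin _ hprod)
  have hεw : 0 < ε * (μ a * ν b) := mul_pos hε (mul_pos (hμ a) (hν b))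
  set s := (Δ + 1) / (ε * (μ a * ν b)) with hs
  have hs0 : 0 ≤ s := by positivity
  have hmul : ε * (μ a * ν b) * s = Δ + 1 := mul_div_cancel₀ _ hεw.ne'
  have ht0 : 0 < Real.exp (-s) := Real.exp_pos _
  have ht1 : Real.exp (-s) ≤ 1 := Real.exp_le_one_iff.2 (neg_nonpos.2 hs0)
  have hle := (hmin _ (hπ.convexComb hprod ht0.le ht1)).trans
    (entropicObj_convexComb_le C hμ hν hε.le hπ.1 hab ht0.le ht1)
  rw [Real.log_exp] at hle
  have heq : ε * (Real.exp (-s) * (μ a * ν b)) * -s = -(Real.exp (-s) * (Δ + 1)) := by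
    rw [← hmul]
    ring
  rw [heq, hΔ] at hle
  linarith

/-- The first-order condition at a positive minimizer, in a direction `u ⊗ v` that preserves
both marginals. -/
theorem sum_mul_eq_zero_of_entropic_minimizer {n m : ℕ} {C : Fin n → Fin m → ℝ}
    {μ : Fin n → ℝ} {ν : Fin m → ℝ} (hμ : ∀ i, μ i ≠ 0) (hν : ∀ j, ν j ≠ 0)
    {ε : ℝ} {π : Fin n → Fin m → ℝ} (hπ : IsCoupling μ ν π) (hpos : ∀ i j, 0 < π i j)
    (hmin : ∀ π', IsCoupling μ ν π' → entropicObj C μ ν ε π ≤ entropicObj C μ ν ε π')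
    {u : Fin n → ℝ} {v : Fin m → ℝ} (hu : ∑ i, u i = 0) (hv : ∑ j, v j = 0) :
    ∑ i, ∑ j, (C i j + ε * Real.log (π i j / (μ i * ν j))) * (u i * v j) = 0 := by
  let γ : ℝ → Fin n → Fin m → ℝ := fun t i j => π i j + t * (u i * v j)
  have hγ0 : γ 0 = π := by simp [γ]
  have hcoupling : ∀ᶠ t in nhds (0 : ℝ), IsCoupling μ ν (γ t) := by
    have hγpos : ∀ᶠ t in nhds (0 : ℝ), ∀ i j, 0 < γ t i j := by
      refine Filter.eventually_all.2 fun i => Filter.eventually_all.2 fun j => ?_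
      have hcont : Continuous fun t => γ t i j := by fun_prop
      exact hcont.continuousAt.eventually_const_lt (by simpa [γ] using hpos i j)
    filter_upwards [hγpos] with t ht
    refine ⟨fun i j => (ht i j).le, fun i => ?_, fun j => ?_⟩
    · simp only [γ, Finset.sum_add_distrib, ← Finset.mul_sum, hπ.2.1, hv, mul_zero, add_zero]
    · simp only [γ, Finset.sum_add_distrib, ← Finset.mul_sum, ← Finset.sum_mul, hπ.2.2, hu,
        zero_mul, mul_zero, add_zero]
  have hlocal : IsLocalMin (fun t => entropicObj C μ ν ε (γ t)) 0 := by
    filter_upwards [hcoupling] with t ht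
    rw [hγ0]
    exact hmin _ ht
  refine hlocal.hasDerivAt_eq_zero ?_
  simp only [entropicObj_eq_sum_entropicTerm]
  refine HasDerivAt.add_const _ (HasDerivAt.fun_sum fun i _ => HasDerivAt.fun_sum fun j _ => ?_)
  have hγ : HasDerivAt (fun t => γ t i j) (u i * v j) 0 := by
    simpa [γ] using (hasDerivAt_id (0 : ℝ)).mul_const (u i * v j)
  have hterm : HasDerivAt (entropicTerm ε (C i j) (μ i * ν j))
      (C i j + ε * Real.log (π i j / (μ i * ν j))) (γ 0 i j) := by
    rw [hγ0]
    exact hasDerivAt_entropicTerm ε (C i j) (mul_ne_zero (hμ i) (hν j)) (hpos i j).ne'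
  exact hterm.comp 0 hγ

/-- A minimizer of the entropic objective over the coupling set has the Gibbs kernel
structure `π_ij = μ_i ν_j exp((α_i + β_j - C_ij)/ε)`; in particular all its entries
are strictly positive. -/
theorem entropic_minimizer_gibbs_structure
    (n m : ℕ) (hn : 1 ≤ n) (hm : 1 ≤ m)
    (C : Fin n → Fin m → ℝ)
    (μ : Fin n → ℝ) (ν : Fin m → ℝ)
    (hμpos : ∀ i, 0 < μ i) (hμsum : ∑ i, μ i = 1)
    (hνpos : ∀ j, 0 < ν j) (hνsum : ∑ j, ν j = 1)
    (ε : ℝ) (hε : 0 < ε)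
    (π : Fin n → Fin m → ℝ)
    (hπ : IsCoupling μ ν π)
    (hmin : ∀ π', IsCoupling μ ν π' →
      entropicObj C μ ν ε π ≤ entropicObj C μ ν ε π') :
    (∃ (α : Fin n → ℝ) (β : Fin m → ℝ), ∀ i j,
      π i j = μ i * ν j * Real.exp ((α i + β j - C i j) / ε)) ∧
    ∀ i j, 0 < π i j := by
  have hpos := pos_of_entropic_minimizer hμpos hμsum hνpos hνsum hε hπ hmin
  refine ⟨?_, hpos⟩
  let G : Fin n → Fin m → ℝ := fun i j => C i j + ε * Real.log (π i j / (μ i * ν j))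
  let a : Fin n := ⟨0, hn⟩
  let b : Fin m := ⟨0, hm⟩
  have hG : ∀ i j, G i j = G i b + (G a j - G a b) := fun i j => by
    have h : ∑ i', ∑ j', G i' j' * ((Pi.single i 1 - Pi.single a 1 : Fin n → ℝ) i' *
        (Pi.single j 1 - Pi.single b 1 : Fin m → ℝ) j') = 0 :=
      sum_mul_eq_zero_of_entropic_minimizer (fun i => (hμpos i).ne') (fun j => (hνpos j).ne')
        hπ hpos hmin (by simp) (by simp)
    simp only [Pi.sub_apply, mul_sub, Finset.sum_sub_distrib, Pi.single_apply, mul_ite, mul_one,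
      mul_zero, Finset.sum_ite_eq', Finset.mem_univ, if_true] at h
    linarith
  refine ⟨fun i => G i b, fun j => G a j - G a b, fun i j => ?_⟩
  have hw : 0 < μ i * ν j := mul_pos (hμpos i) (hνpos j)
  rw [← hG i j]
  simp only [G, add_sub_cancel_left]
  rw [mul_div_cancel_left₀ _ hε.ne', Real.exp_log (div_pos (hpos i j) hw),
    mul_div_cancel₀ _ hw.ne']
end

section
/- Let $n, m \geq 1$, let $C \in \mathbb{R}^{n \times m}$, let $\mu \in \Sigma_n$ and $\nu \in \Sigma_m$ have strictly positive entries, and let $\varepsilon > 0$. Suppose $\pi \in \Pi(\mu,\nu)$ and there exist $\alpha \in \mathbb{R}^n$, $\beta \in \mathbb{R}^m$ with $\pi_{ij} = \mu_i \, \nu_j \, \exp((\alpha_i + \beta_j - C_{ij})/\varepsilon)$ for all $i,j$. Then $\pi$ is the unique minimizer of the entropic objective $F_\varepsilon(\pi') = \sum_{i,j} C_{ij}\pi'_{ij} + \varepsilon\, \mathrm{KL}(\pi' \| \mu \otimes \nu)$ over $\Pi(\mu,\nu)$: for every $\pi' \in \Pi(\mu,\nu)$ with $\pi' \neq \pi$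 one has $F_\varepsilon(\pi) < F_\varepsilon(\pi')$. -/
/-- On couplings, the entropic objective is an affine constant plus `ε` times the generalized
Kullback-Leibler divergence to the Gibbs kernel `π`. -/
theorem entropicObj_eq_add_klFun_of_gibbs {n m : ℕ} {C : Fin n → Fin m → ℝ}
    {μ : Fin n → ℝ} {ν : Fin m → ℝ} (hμpos : ∀ i, 0 < μ i) (hνpos : ∀ j, 0 < ν j)
    {ε : ℝ} (hε : 0 < ε) {π : Fin n → Fin m → ℝ} {α : Fin n → ℝ} {β : Fin m → ℝ}
    (hgibbs : ∀ i j, π i j = μ i * ν j * Real.exp ((α i + β j - C i j) / ε))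
    {ρ : Fin n → Fin m → ℝ} (hρ : IsCoupling μ ν ρ) :
    entropicObj C μ ν ε ρ =
      (∑ i, α i * μ i + ∑ j, β j * ν j + ε * (1 - ∑ i, ∑ j, π i j)) +
        ε * ∑ i, ∑ j, π i j * InformationTheory.klFun (ρ i j / π i j) := by
  obtain ⟨-, hrow, hcol⟩ := hρ
  have hterm (i : Fin n) (j : Fin m) :
      C i j * ρ i j + ε * (ρ i j * (Real.log (ρ i j / (μ i * ν j)) - 1)) =
        α i * ρ i j + β j * ρ i j - ε * π i j +
          ε * (π i j * InformationTheory.klFun (ρ i j / π i j)) := by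
    have hμν : 0 < μ i * ν j := mul_pos (hμpos i) (hνpos j)
    have hπ : 0 < π i j := hgibbs i j ▸ mul_pos hμν (Real.exp_pos _)
    rcases eq_or_ne (ρ i j) 0 with h0 | h0
    · simp [h0, InformationTheory.klFun_zero]
    have hlog : Real.log (ρ i j / π i j) =
        Real.log (ρ i j / (μ i * ν j)) - (α i + β j - C i j) / ε := by
      rw [hgibbs, ← div_div, Real.log_div (div_ne_zero h0 hμν.ne') (Real.exp_ne_zero _),
        Real.log_exp]
    rw [InformationTheory.klFun_apply, hlog]
    field_simp
    ring
  have hsum := Finset.sum_congr rfl fun i (_ : i ∈ Finset.univ) =>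
    Finset.sum_congr rfl fun j (_ : j ∈ Finset.univ) => hterm i j
  simp only [Finset.sum_add_distrib, Finset.sum_sub_distrib, ← Finset.mul_sum, hrow] at hsum
  have hβ : ∑ i, ∑ j, β j * ρ i j = ∑ j, β j * ν j := by
    rw [Finset.sum_comm]
    simp only [← Finset.mul_sum, hcol]
  rw [hβ] at hsum
  unfold entropicObj
  linarith

/-- A coupling with the Gibbs kernel structure is the unique minimizer of the
entropic objective over the coupling set: every other coupling has a strictly
larger objective value. -/
theorem gibbs_structure_implies_unique_minimizer
    (n m : ℕ) (hn : 1 ≤ n) (hm : 1 ≤ m)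
    (C : Fin n → Fin m → ℝ)
    (μ : Fin n → ℝ) (ν : Fin m → ℝ)
    (hμpos : ∀ i, 0 < μ i) (hμsum : ∑ i, μ i = 1)
    (hνpos : ∀ j, 0 < ν j) (hνsum : ∑ j, ν j = 1)
    (ε : ℝ) (hε : 0 < ε)
    (π : Fin n → Fin m → ℝ)
    (hπ : IsCoupling μ ν π)
    (α : Fin n → ℝ) (β : Fin m → ℝ)
    (hgibbs : ∀ i j, π i j = μ i * ν j * Real.exp ((α i + β j - C i j) / ε)) :
    ∀ π', IsCoupling μ ν π' → π' ≠ π →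
      entropicObj C μ ν ε π < entropicObj C μ ν ε π' := by
  intro ρ hρ hne
  have hπpos (i : Fin n) (j : Fin m) : 0 < π i j :=
    hgibbs i j ▸ mul_pos (mul_pos (hμpos i) (hνpos j)) (Real.exp_pos _)
  have hnonneg (i : Fin n) (j : Fin m) : 0 ≤ π i j * InformationTheory.klFun (ρ i j / π i j) :=
    mul_nonneg (hπpos i j).le
      (InformationTheory.klFun_nonneg (div_nonneg (hρ.1 i j) (hπpos i j).le))
  obtain ⟨i, hi⟩ := Function.ne_iff.mp hne
  obtain ⟨j, hij⟩ := Function.ne_iff.mp hi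
  have hpos : 0 < π i j * InformationTheory.klFun (ρ i j / π i j) := by
    refine (hnonneg i j).lt_of_ne' (mul_ne_zero (hπpos i j).ne' ?_)
    rw [Ne, InformationTheory.klFun_eq_zero_iff (div_nonneg (hρ.1 i j) (hπpos i j).le),
      div_eq_one_iff_eq (hπpos i j).ne']
    exact hij
  have hsum : 0 < ∑ i, ∑ j, π i j * InformationTheory.klFun (ρ i j / π i j) :=
    Finset.sum_pos' (fun i _ => Finset.sum_nonneg fun j _ => hnonneg i j)
      ⟨i, Finset.mem_univ i, Finset.sum_pos' (fun j _ => hnonneg i j) ⟨j, Finset.mem_univ j, hpos⟩⟩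
  rw [entropicObj_eq_add_klFun_of_gibbs hμpos hνpos hε hgibbs hπ,
    entropicObj_eq_add_klFun_of_gibbs hμpos hνpos hε hgibbs hρ]
  simp only [div_self (hπpos _ _).ne', InformationTheory.klFun_one, mul_zero,
    Finset.sum_const_zero]
  gcongr
  exact mul_pos hε hsum
end

section
/- Let $n, m \geq 1$, let $C \in \mathbb{R}^{n \times m}$, and let $\mu \in \Sigma_n$, $\nu \in \Sigma_m$ have strictly positive entries. For each $\varepsilon > 0$ let $\pi^\varepsilon$ denote the unique minimizer over $\Pi(\mu,\nu)$ of the entropic objective $F_\varepsilon(\pi) = \sum_{i,j} C_{ij}\pi_{ij} + \varepsilon\, \mathrm{KL}(\pi \| \mu \otimes \nu)$. Then for any sequence $\varepsilon_k \to 0^+$, every cluster point of the sequence $(\pi^{\varepsilon_k})_k$ in $\mathbb{R}^{n \times m}$ is a minimizer of the unregularized cost $\pi \mapsto \sum_{i,j} C_{ij}\pi_{ij}$ over $\Pi(\mu,\nu)$. -/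
theorem isClosed_setOf_isCoupling {n m : ℕ} (μ : Fin n → ℝ) (ν : Fin m → ℝ) :
    IsClosed {π : Fin n → Fin m → ℝ | IsCoupling μ ν π} := by
  simp only [IsCoupling, Set.ofPred_and, Set.ofPred_forall]
  refine IsClosed.inter ?_ (IsClosed.inter ?_ ?_)
  · exact isClosed_iInter fun i => isClosed_iInter fun j =>
      isClosed_le continuous_const (by fun_prop)
  · exact isClosed_iInter fun i => isClosed_eq (by fun_prop) continuous_const
  · exact isClosed_iInter fun j => isClosed_eq (by fun_prop) continuous_const

theorem continuous_mul_log_div_sub_one {c : ℝ} (hc : c ≠ 0) :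
    Continuous fun x : ℝ => x * (Real.log (x / c) - 1) := by
  have h : Continuous fun x : ℝ => c * (x / c * Real.log (x / c)) - x :=
    (continuous_const.mul
      (Real.continuous_mul_log.comp (continuous_id.div_const c))).sub continuous_id
  refine h.congr fun x => ?_
  field_simp

theorem continuous_entropicObj {n m : ℕ} (C : Fin n → Fin m → ℝ)
    {μ : Fin n → ℝ} {ν : Fin m → ℝ} (hμ : ∀ i, μ i ≠ 0) (hν : ∀ j, ν j ≠ 0) :
    Continuous fun p : ℝ × (Fin n → Fin m → ℝ) => entropicObj C μ ν p.1 p.2 := by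
  have h : ∀ i j, Continuous fun p : ℝ × (Fin n → Fin m → ℝ) =>
      p.2 i j * (Real.log (p.2 i j / (μ i * ν j)) - 1) := fun i j =>
    (continuous_mul_log_div_sub_one (mul_ne_zero (hμ i) (hν j))).comp
      (g := fun x : ℝ => x * (Real.log (x / (μ i * ν j)) - 1)) (by fun_prop)
  unfold entropicObj
  fun_prop

/-- As `ε_k → 0⁺`, every cluster point of the entropic minimizers `π^{ε_k}` is a
minimizer of the unregularized transport cost over the coupling set. -/
theorem entropic_cluster_point_minimizes_unregularized
    (n m : ℕ) (hn : 1 ≤ n) (hm : 1 ≤ m)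
    (C : Fin n → Fin m → ℝ)
    (μ : Fin n → ℝ) (ν : Fin m → ℝ)
    (hμpos : ∀ i, 0 < μ i) (hμsum : ∑ i, μ i = 1)
    (hνpos : ∀ j, 0 < ν j) (hνsum : ∑ j, ν j = 1)
    (P : ℝ → Fin n → Fin m → ℝ)
    (hPmin : ∀ ε : ℝ, 0 < ε → IsCoupling μ ν (P ε) ∧
      ∀ π', IsCoupling μ ν π' → entropicObj C μ ν ε (P ε) ≤ entropicObj C μ ν ε π')
    (εseq : ℕ → ℝ) (hεpos : ∀ k, 0 < εseq k)
    (hεto0 : Filter.Tendsto εseq Filter.atTop (nhdsWithin 0 (Set.Ioi 0)))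
    (πlim : Fin n → Fin m → ℝ)
    (hcluster : MapClusterPt πlim Filter.atTop (fun k => P (εseq k))) :
    IsCoupling μ ν πlim ∧
      ∀ π, IsCoupling μ ν π →
        (∑ i, ∑ j, C i j * πlim i j) ≤ ∑ i, ∑ j, C i j * π i j := by
  obtain ⟨U, hU, hP⟩ := mapClusterPt_iff_ultrafilter.1 hcluster
  have hε : Filter.Tendsto εseq U (nhds 0) :=
    (hεto0.mono_right nhdsWithin_le_nhds).mono_left hU
  refine ⟨(isClosed_setOf_isCoupling μ ν).mem_of_tendsto hP
    (Filter.Eventually.of_forall fun k => (hPmin _ (hεpos k)).1), fun π hπ => ?_⟩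
  have hF := continuous_entropicObj C (fun i => (hμpos i).ne') (fun j => (hνpos j).ne')
  have hle := le_of_tendsto_of_tendsto'
    ((hF.tendsto (0, πlim)).comp (hε.prodMk_nhds hP))
    ((hF.tendsto (0, π)).comp (hε.prodMk_nhds tendsto_const_nhds))
    (fun k => (hPmin _ (hεpos k)).2 π hπ)
  simpa [entropicObj] using hle
end
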